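/- If the substituted term t[x:=u] is strongly normalizing for the combined reduction by β, δ, γ and assoc, then t is strongly normalizing, and moreover η(t) ≤ η(t[x:=u]), where η denotes the length of the longest reduction sequence. -/

import Mathlib

/-- Untyped λ-terms in de Bruijn representation. -/
inductive Lam : Type
  | var : ℕ → Lam
  | lam : Lam → Lam
  | app : Lam → Lam → Lam

namespace Lam

/-- Renaming of de Bruijn indices (extended under binders). -/
def rename (f : ℕ → ℕ) : Lam → Lam
  | var n => var (f n)
  | lam b => lam (rename (fun n => match n with | 0 => 0 | m+1 => f m + 1) b)
  | app a b => app (rename f a) (rename f b)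

/-- Shift all free indices up by one. -/
def shift : Lam → Lam := rename Nat.succ

/-- Swap the two innermost free indices. -/
def swap01 : Lam → Lam := rename (fun n => match n with | 0 => 1 | 1 => 0 | m => m)

/-- Capture-avoiding substitution of `u` for the free variable (index) `k`. -/
def subst : Lam → ℕ → Lam → Lam
  | var n, k, u => if n = k then u else if k < n then var (n-1) else var n
  | lam b, k, u => lam (subst b (k+1) (shift u))
  | app a b, k, u => app (subst a k u) (subst b k u)

/-- The names of the four reduction rules. -/
inductive Rule | beta | delta | gamma | assoc

/-- One-step reduction by a given rule, closed under all term contexts.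
β : (λx.M) N ▷ M[x:=N]
δ : (λy.λx.M) N ▷ λx.((λy.M) N)   (x ∉ FV N)
γ : ((λx.M) N) P ▷ (λx.(M P)) N   (x ∉ FV P)
assoc : M ((λx.N) P) ▷ (λx.(M N)) P   (x ∉ FV M) -/
inductive StepR : Rule → Lam → Lam → Prop
  | beta (M N) : StepR .beta (app (lam M) N) (subst M 0 N)
  | delta (M N) : StepR .delta (app (lam (lam M)) N) (lam (app (lam (swap01 M)) (shift N)))
  | gamma (M N P) : StepR .gamma (app (app (lam M) N) P) (app (lam (app M (shift P))) N)
  | assoc (M N P) : StepR .assoc (app M (app (lam N) P)) (app (lam (app (shift M) N)) P)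
  | appL {r M M'} (N) : StepR r M M' → StepR r (app M N) (app M' N)
  | appR {r N N'} (M) : StepR r N N' → StepR r (app M N) (app M N')
  | under {r M M'} : StepR r M M' → StepR r (lam M) (lam M')

/-- One-step reduction by any of β, δ, γ, assoc. -/
def Step (t t' : Lam) : Prop := ∃ r, StepR r t t'

/-- One-step β-reduction alone. -/
def StepBeta : Lam → Lam → Prop := StepR Rule.beta

/-- `t` is strongly normalizing for the reduction relation `R`:
every `R`-reduction sequence from `t` is finite. -/
def SN (R : Lam → Lam → Prop) (t : Lam) : Prop := Acc (fun a b => R b a) t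

/-- Left-nested application `(H M₁ … Mₙ)`. -/
def apps : Lam → List Lam → Lam
  | H, [] => H
  | H, M :: Ms => apps (app H M) Ms

/-- Types of system 𝒟 : atoms, arrow and intersection. -/
inductive Ty : Type
  | atom : ℕ → Ty
  | arrow : Ty → Ty → Ty
  | inter : Ty → Ty → Ty

/-- Typing judgment of system 𝒟 (contexts are lists of types, de Bruijn style). -/
inductive Typed : List Ty → Lam → Ty → Prop
  | var {Γ n A} : Γ[n]? = some A → Typed Γ (var n) A
  | app {Γ M N A B} : Typed Γ M (.arrow A B) → Typed Γ N A → Typed Γ (app M N) B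
  | lam {Γ M A B} : Typed (A :: Γ) M B → Typed Γ (lam M) (.arrow A B)
  | interI {Γ M A B} : Typed Γ M A → Typed Γ M B → Typed Γ M (.inter A B)
  | interE1 {Γ M A B} : Typed Γ M (.inter A B) → Typed Γ M A
  | interE2 {Γ M A B} : Typed Γ M (.inter A B) → Typed Γ M B

/-- A term is typable in system 𝒟 if it has a type in some context. -/
def Typable (t : Lam) : Prop := ∃ Γ A, Typed Γ t A

end Lam

namespace Lam

/-- `NSteps t n s` : there is a reduction sequence of length `n` from `t` to `s`
(using the rules β, δ, γ, assoc). -/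
inductive NSteps : Lam → ℕ → Lam → Prop
  | refl (t) : NSteps t 0 t
  | step {t t' s n} : Step t t' → NSteps t' n s → NSteps t (n+1) s

end Lam

namespace Lam

/-- Extension of a renaming under a binder. -/
def upRen (f : ℕ → ℕ) : ℕ → ℕ
  | 0 => 0
  | m + 1 => f m + 1

/-- Extension of a parallel substitution under a binder. -/
def up (σ : ℕ → Lam) : ℕ → Lam
  | 0 => var 0
  | m + 1 => shift (σ m)

/-- Parallel capture-avoiding substitution. -/
def inst (σ : ℕ → Lam) : Lam → Lam
  | var n => σ n
  | lam b => lam (inst (up σ) b)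
  | app a b => app (inst σ a) (inst σ b)

/-- The parallel substitution that replaces the index `k` by `u`. -/
def single (k : ℕ) (u : Lam) (n : ℕ) : Lam :=
  if n = k then u else if k < n then var (n - 1) else var n

theorem rename_lam (f : ℕ → ℕ) (b : Lam) : rename f (lam b) = lam (rename (upRen f) b) := by
  have h : (fun n => match n with | 0 => 0 | m + 1 => f m + 1) = upRen f := by
    funext n
    cases n <;> rfl
  rw [← h, rename]

theorem rename_rename (t : Lam) (f g : ℕ → ℕ) :
    rename f (rename g t) = rename (fun n => f (g n)) t := by
  induction t generalizing f g with
  | var n => rfl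
  | lam b ih =>
    rw [rename_lam, rename_lam, rename_lam, ih]
    congr 2
    funext n
    cases n <;> rfl
  | app a b iha ihb => simp only [rename, iha, ihb]

theorem rename_upRen_shift (f : ℕ → ℕ) (t : Lam) :
    rename (upRen f) (shift t) = shift (rename f t) := by
  simp only [shift, rename_rename]
  rfl

theorem inst_rename (t : Lam) (σ : ℕ → Lam) (f : ℕ → ℕ) :
    inst σ (rename f t) = inst (fun n => σ (f n)) t := by
  induction t generalizing σ f with
  | var n => rfl
  | lam b ih =>
    rw [rename_lam, inst, inst, ih]
    congr 2
    funext n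
    cases n <;> rfl
  | app a b iha ihb => simp only [rename, inst, iha, ihb]

theorem rename_inst (t : Lam) (σ : ℕ → Lam) (f : ℕ → ℕ) :
    rename f (inst σ t) = inst (fun n => rename f (σ n)) t := by
  induction t generalizing σ f with
  | var n => rfl
  | lam b ih =>
    rw [inst, inst, rename_lam, ih]
    congr 2
    funext n
    cases n with
    | zero => rfl
    | succ m => exact rename_upRen_shift f (σ m)
  | app a b iha ihb => simp only [rename, inst, iha, ihb]

theorem inst_up_shift (σ : ℕ → Lam) (t : Lam) : inst (up σ) (shift t) = shift (inst σ t) := by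
  simp only [shift, inst_rename, rename_inst]
  rfl

theorem inst_inst (t : Lam) (σ τ : ℕ → Lam) :
    inst σ (inst τ t) = inst (fun n => inst σ (τ n)) t := by
  induction t generalizing σ τ with
  | var n => rfl
  | lam b ih =>
    rw [inst, inst, inst, ih]
    congr 2
    funext n
    cases n with
    | zero => rfl
    | succ m => exact inst_up_shift σ (τ m)
  | app a b iha ihb => simp only [inst, iha, ihb]

theorem up_var : up var = var := by
  funext n
  cases n <;> rfl

theorem inst_var (t : Lam) : inst var t = t := by
  induction t with
  | var n => rfl
  | lam b ih => rw [inst, up_var, ih]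
  | app a b iha ihb => rw [inst, iha, ihb]

theorem up_single (k : ℕ) (u : Lam) : up (single k u) = single (k + 1) (shift u) := by
  funext n
  cases n with
  | zero => simp [up, single]
  | succ m =>
    rcases lt_trichotomy m k with h | h | h
    · simp [up, single, shift, rename, h.ne, h.not_gt]
    · simp [up, single, h]
    · obtain ⟨j, rfl⟩ : ∃ j, m = j + 1 := ⟨m - 1, by omega⟩
      simp [up, single, shift, rename, h.ne', Nat.le_of_lt_succ h]

theorem subst_eq_inst (t : Lam) (k : ℕ) (u : Lam) : subst t k u = inst (single k u) t := by
  induction t generalizing k u with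
  | var n => rfl
  | lam b ih => rw [subst, inst, ih, up_single]
  | app a b iha ihb => rw [subst, inst, iha, ihb]

theorem inst_subst_zero (σ : ℕ → Lam) (M N : Lam) :
    inst σ (subst M 0 N) = subst (inst (up σ) M) 0 (inst σ N) := by
  simp only [subst_eq_inst, inst_inst]
  congr 1
  funext n
  cases n with
  | zero => rfl
  | succ m =>
    rw [up, shift, inst_rename]
    exact (inst_var (σ m)).symm

theorem inst_swap01 (σ : ℕ → Lam) (M : Lam) :
    inst (up (up σ)) (swap01 M) = swap01 (inst (up (up σ)) M) := by
  simp only [swap01, inst_rename, rename_inst]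
  congr 1
  funext n
  match n with
  | 0 => rfl
  | 1 => rfl
  | m + 2 =>
    simp only [up, shift, rename_rename]

theorem StepR.inst {r : Rule} {t t' : Lam} (h : StepR r t t') (σ : ℕ → Lam) :
    StepR r (t.inst σ) (t'.inst σ) := by
  induction h generalizing σ with
  | beta M N =>
    rw [inst_subst_zero]
    exact .beta _ _
  | delta M N =>
    simp only [Lam.inst, inst_swap01, inst_up_shift]
    exact .delta _ _
  | gamma M N P =>
    simp only [Lam.inst, inst_up_shift]
    exact .gamma _ _ _
  | assoc M N P =>
    simp only [Lam.inst, inst_up_shift]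
    exact .assoc _ _ _
  | appL N _ ih => exact .appL _ (ih σ)
  | appR M _ ih => exact .appR _ (ih σ)
  | under _ ih => exact .under (ih _)

theorem Step.subst {t t' : Lam} (h : Step t t') (x : ℕ) (u : Lam) :
    Step (t.subst x u) (t'.subst x u) := by
  obtain ⟨r, hr⟩ := h
  rw [subst_eq_inst, subst_eq_inst]
  exact ⟨r, hr.inst _⟩

theorem NSteps.subst {t s : Lam} {n : ℕ} (h : NSteps t n s) (x : ℕ) (u : Lam) :
    NSteps (t.subst x u) n (s.subst x u) := by
  induction h with
  | refl t => exact .refl _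
  | step h _ ih => exact .step (h.subst x u) ih

end Lam

open Lam in
/-- If `t[x:=u]` is strongly normalizing (for the combined reduction
by β, δ, γ, assoc) then so is `t`, and moreover η(t) ≤ η(t[x:=u]): every length
of a reduction sequence from `t` is also the length of a reduction sequence from
`t[x:=u]`. -/
theorem sn_of_subst_sn (t : Lam) (x : ℕ) (u : Lam) (h : SN Step (t.subst x u)) :
    SN Step t ∧ ∀ n, (∃ s, NSteps t n s) → ∃ s', NSteps (t.subst x u) n s' := by
  refine ⟨?_, fun n ⟨s, hs⟩ => ⟨s.subst x u, hs.subst x u⟩⟩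
  exact Subrelation.accessible (fun hst => Step.subst hst x u) (InvImage.accessible (Lam.subst · x u) h)
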